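/- Let 𝒢 = (G_0,G_1,…,G_q) be a fully-coloured AD-pure q-multicolouring of a finite graph G = (V,E), let T ⊆ V be σ_𝒢-maximal, and let 𝒢' = unclr(𝒢;T) = (G'_0,…,G'_q). Then: (1) ν(G'_j) ≤ ν(G_j) for every j ∈ {1,…,q}; (2) Σ_{j=1}^q ν(G'_j) ≤ Σ_{j=1}^q ν(G_j) − |T|; (3) 𝒢' is a T-proper, D-pure, acyclic q-multicolouring of G. -/

import Mathlib

open SimpleGraph

variable {V : Type*}

/-- `M` is a set of edges of `G` forming a matching (pairwise disjoint edges). -/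
def IsMatchingSet (G : SimpleGraph V) (M : Finset (Sym2 V)) : Prop :=
  (∀ e ∈ M, e ∈ G.edgeSet) ∧
    ∀ e ∈ M, ∀ f ∈ M, e ≠ f → ∀ v : V, v ∈ e → v ∉ f

/-- The matching number `ν(G)`. -/
noncomputable def matchingNumber (G : SimpleGraph V) : ℕ :=
  sSup {n | ∃ M : Finset (Sym2 V), IsMatchingSet G M ∧ M.card = n}

/-- `ν_G(X,Y)`: the maximum size of a matching of `G` each edge of which has one
endpoint in `X` and one endpoint in `Y`. -/
noncomputable def nuBetween (G : SimpleGraph V) (X Y : Set V) : ℕ :=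
  sSup {n | ∃ M : Finset (Sym2 V), IsMatchingSet G M ∧ M.card = n ∧
    ∀ e ∈ M, ∃ x ∈ X, ∃ y ∈ Y, e = s(x, y)}

/-- The set `D` of the Gallai–Edmonds decomposition: the inessential vertices,
i.e. those missed by some maximum matching. -/
def geD (G : SimpleGraph V) : Set V :=
  {v | ∃ M : Finset (Sym2 V), IsMatchingSet G M ∧ M.card = matchingNumber G ∧ ∀ e ∈ M, v ∉ e}

/-- The set `A` of the Gallai–Edmonds decomposition: vertices outside `D` with a
neighbour in `D`. -/
def geA (G : SimpleGraph V) : Set V :=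
  {v | v ∉ geD G ∧ ∃ u ∈ geD G, G.Adj v u}

/-- The set `C` of the Gallai–Edmonds decomposition: the remaining vertices. -/
def geC (G : SimpleGraph V) : Set V :=
  {v | v ∉ geD G ∧ v ∉ geA G}

/-- `G` is an `s`-connector: any two disjoint vertex sets of size at least `s`
are joined by an edge. -/
def IsConnector (G : SimpleGraph V) (s : ℕ) : Prop :=
  ∀ X Y : Set V, Disjoint X Y → s ≤ X.ncard → s ≤ Y.ncard →
    ∃ x ∈ X, ∃ y ∈ Y, G.Adj x y

/-- `G → (t₁K₂, …, t_qK₂)`: every `q`-colouring of the edges of `G` admits a colour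
`j` and a `j`-monochromatic matching of size `t j`. -/
def ArrowsMatch (G : SimpleGraph V) {q : ℕ} (t : Fin q → ℕ) : Prop :=
  ∀ c : Sym2 V → Fin q, ∃ j : Fin q, ∃ M : Finset (Sym2 V),
    IsMatchingSet G M ∧ M.card = t j ∧ ∀ e ∈ M, c e = j

/-- The induced subgraph `G[S]`, viewed as a graph on the same vertex set. -/
def inducedOn (G : SimpleGraph V) (S : Set V) : SimpleGraph V where
  Adj a b := G.Adj a b ∧ a ∈ S ∧ b ∈ S
  symm := ⟨fun _ _ ⟨h, ha, hb⟩ => ⟨h.symm, hb, ha⟩⟩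
  loopless := ⟨fun a h => G.loopless.irrefl a h.1⟩

/-- Remove from `G` every edge incident to `S`. -/
def removeIncident (G : SimpleGraph V) (S : Set V) : SimpleGraph V where
  Adj a b := G.Adj a b ∧ a ∉ S ∧ b ∉ S
  symm := ⟨fun _ _ ⟨h, ha, hb⟩ => ⟨h.symm, hb, ha⟩⟩
  loopless := ⟨fun a h => G.loopless.irrefl a h.1⟩

/-- The subgraph of `G` consisting of the edges incident to `S`. -/
def incidentSub (G : SimpleGraph V) (S : Set V) : SimpleGraph V where
  Adj a b := G.Adj a b ∧ (a ∈ S ∨ b ∈ S)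
  symm := ⟨fun _ _ ⟨h, hs⟩ => ⟨h.symm, hs.symm⟩⟩
  loopless := ⟨fun a h => G.loopless.irrefl a h.1⟩

/-- The vertex set of the connected component of `v` in `G`. -/
def compSet (G : SimpleGraph V) (v : V) : Set V := {u | G.Reachable u v}

/-- The family of vertex sets of the connected components of `G[S]` meeting `S`. -/
def compsOn (G : SimpleGraph V) (S : Set V) : Set (Set V) :=
  {K | ∃ v ∈ S, K = compSet (inducedOn G S) v}

/-- `G[S]` is factor-critical: for every `v ∈ S` there is a matching of `G[S]`
avoiding `v` and covering all other vertices of `S`. -/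
def IsFactorCriticalOn (G : SimpleGraph V) (S : Set V) : Prop :=
  ∀ v ∈ S, ∃ M : Finset (Sym2 V), IsMatchingSet (inducedOn G S) M ∧
    (∀ e ∈ M, v ∉ e) ∧ ∀ u ∈ S, u ≠ v → ∃ e ∈ M, u ∈ e

/-- The bipartite incidence graph of an indexed (multi)hypergraph. -/
def incGraph {ι : Type*} (E : ι → Set V) : SimpleGraph (V ⊕ ι) where
  Adj x y :=
    (∃ v i, x = Sum.inl v ∧ y = Sum.inr i ∧ v ∈ E i) ∨
    (∃ v i, x = Sum.inr i ∧ y = Sum.inl v ∧ v ∈ E i)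
  symm := by
    constructor
    rintro x y (⟨v, i, rfl, rfl, h⟩ | ⟨v, i, rfl, rfl, h⟩)
    · exact Or.inr ⟨v, i, rfl, rfl, h⟩
    · exact Or.inl ⟨v, i, rfl, rfl, h⟩
  loopless := by
    constructor
    rintro x (⟨v, i, rfl, h, -⟩ | ⟨v, i, rfl, h, -⟩) <;> simp at h

/-- An indexed (multi)hypergraph is a hyperforest if its incidence graph has no cycle. -/
def IsHyperforest {ι : Type*} (E : ι → Set V) : Prop := (incGraph E).IsAcyclic

/-- Index type of the multihypergraph `𝒞(𝒢)` of monochromatic connected components: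
a colour together with the vertex set of a component of that colour graph. -/
def CompIdx {q : ℕ} (Gc : Fin q → SimpleGraph V) : Type _ :=
  Σ j : Fin q, {K : Set V // ∃ v : V, K = compSet (Gc j) v}

/-- The hyperedges of the multihypergraph `𝒞(𝒢)`. -/
def CompEdge {q : ℕ} (Gc : Fin q → SimpleGraph V) : CompIdx Gc → Set V :=
  fun p => (p.2 : Set V)

/-- A coloured graph is acyclic if `𝒞(𝒢)` is a hyperforest. -/
def ColouringAcyclic {q : ℕ} (Gc : Fin q → SimpleGraph V) : Prop :=
  IsHyperforest (CompEdge Gc)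

/-- `(G₀, G₁, …, G_q)` is a `q`-multicolouring of `G`: the union of all
(coloured and uncoloured) edge sets is the edge set of `G`. -/
def IsMulticolouring (G G0 : SimpleGraph V) {q : ℕ} (Gc : Fin q → SimpleGraph V) : Prop :=
  G0 ⊔ (⨆ j, Gc j) = G

/-- The colouring `(G₀, G₁, …, G_q)` of `G` is `S`-proper: the uncoloured edges are
exactly the edges of `G` incident to `S`, and they carry no colour. -/
def IsSProper (G G0 : SimpleGraph V) {q : ℕ} (Gc : Fin q → SimpleGraph V) (S : Set V) : Prop :=
  G0.edgeSet = {e | e ∈ G.edgeSet ∧ ∃ v ∈ S, v ∈ e} ∧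
    ∀ j, Disjoint G0.edgeSet (Gc j).edgeSet

/-- The potential `σ_𝒢(T) = r_𝒢(T) - |T|`, where
`r_𝒢(T) = ∑_j |A_j ∩ T| + ∑_j ∑_i (ν(G_j[K_j^i]) - ν(G_j[K_j^i ∖ T]))`,
the inner sum running over the components `K_j^i` of `G_j[D_j]`. -/
noncomputable def sigmaCol {q : ℕ} (Gc : Fin q → SimpleGraph V) (T : Set V) : ℤ :=
  ((∑ j : Fin q, ((geA (Gc j) ∩ T).ncard : ℤ))
    + ∑ j : Fin q, ∑ᶠ K ∈ compsOn (Gc j) (geD (Gc j)),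
        ((matchingNumber (inducedOn (Gc j) K) : ℤ)
          - (matchingNumber (inducedOn (Gc j) (K \ T)) : ℤ)))
    - (T.ncard : ℤ)

/-- `T` is `σ_𝒢`-maximal. -/
def SigmaMaximal {q : ℕ} (Gc : Fin q → SimpleGraph V) (T : Set V) : Prop :=
  (∀ S : Set V, sigmaCol Gc S ≤ sigmaCol Gc T) ∧
    ∀ T' : Set V, T ⊂ T' → sigmaCol Gc T' < sigmaCol Gc T

/-- The vertices covered by a set of edges. -/
def coveredBy (M : Finset (Sym2 V)) : Set V := {v | ∃ e ∈ M, v ∈ e}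

theorem IsMatchingSet.mono {G H : SimpleGraph V} (h : G ≤ H) {M : Finset (Sym2 V)}
    (hM : IsMatchingSet G M) : IsMatchingSet H M :=
  ⟨fun e he => SimpleGraph.edgeSet_mono h (hM.1 e he), hM.2⟩

theorem IsMatchingSet.subset {G : SimpleGraph V} {M N : Finset (Sym2 V)}
    (hM : IsMatchingSet G M) (h : N ⊆ M) : IsMatchingSet G N :=
  ⟨fun e he => hM.1 e (h he), fun e he f hf => hM.2 e (h he) f (h hf)⟩

theorem isMatchingSet_empty (G : SimpleGraph V) : IsMatchingSet G ∅ := by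
  simp [IsMatchingSet]

theorem IsMatchingSet.card_le_matchingNumber [Fintype V] {G : SimpleGraph V}
    {M : Finset (Sym2 V)} (hM : IsMatchingSet G M) : M.card ≤ matchingNumber G := by
  classical
  refine le_csSup ⟨Fintype.card (Sym2 V), ?_⟩ ⟨M, hM, rfl⟩
  rintro n ⟨N, -, rfl⟩
  exact Finset.card_le_univ N

theorem exists_isMatchingSet_card_eq [Fintype V] (G : SimpleGraph V) :
    ∃ M, IsMatchingSet G M ∧ M.card = matchingNumber G := by
  classical
  refine Nat.sSup_mem (s := {n | ∃ M, IsMatchingSet G M ∧ M.card = n})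
    ⟨0, ∅, isMatchingSet_empty G, rfl⟩ ⟨Fintype.card (Sym2 V), ?_⟩
  rintro n ⟨N, -, rfl⟩
  exact Finset.card_le_univ N

theorem matchingNumber_mono [Fintype V] {G H : SimpleGraph V} (h : G ≤ H) :
    matchingNumber G ≤ matchingNumber H := by
  obtain ⟨M, hM, hc⟩ := exists_isMatchingSet_card_eq G
  exact hc ▸ (hM.mono h).card_le_matchingNumber

theorem IsMatchingSet.ncard_coveredBy {G : SimpleGraph V} {M : Finset (Sym2 V)}
    (hM : IsMatchingSet G M) : (coveredBy M).ncard = 2 * M.card := by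
  classical
  have h : coveredBy M = ↑(M.biUnion Sym2.toFinset) := by
    ext v
    simp [coveredBy]
  rw [h, Set.ncard_coe_finset, Finset.card_biUnion, Finset.sum_congr rfl, Finset.sum_const,
    smul_eq_mul, mul_comm]
  · intro e he
    exact Sym2.card_toFinset_of_not_isDiag e (G.not_isDiag_of_mem_edgeSet (hM.1 e he))
  · intro e he f hf hef
    refine Finset.disjoint_left.2 fun v hv hv' => ?_
    exact hM.2 e he f hf hef v (Sym2.mem_toFinset.1 hv) (Sym2.mem_toFinset.1 hv')

theorem IsMatchingSet.exists_insert {G : SimpleGraph V} {M : Finset (Sym2 V)}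
    (hM : IsMatchingSet G M) {x y : V} (hxy : G.Adj x y) (hx : x ∉ coveredBy M)
    (hy : y ∉ coveredBy M) :
    ∃ N, IsMatchingSet G N ∧ N.card = M.card + 1 ∧ M ⊆ N ∧ s(x, y) ∈ N ∧
      coveredBy N = coveredBy M ∪ {x, y} := by
  classical
  have hdisj : ∀ e ∈ M, ∀ v ∈ e, v ≠ x ∧ v ≠ y := fun e he v hv =>
    ⟨by rintro rfl; exact hx ⟨e, he, hv⟩, by rintro rfl; exact hy ⟨e, he, hv⟩⟩
  have hnot : s(x, y) ∉ M := fun h => hx ⟨_, h, Sym2.mem_mk_left x y⟩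
  refine ⟨insert s(x, y) M, ⟨?_, ?_⟩, Finset.card_insert_of_notMem hnot,
    Finset.subset_insert _ _, Finset.mem_insert_self _ _, ?_⟩
  · intro e he
    rcases Finset.mem_insert.1 he with rfl | he
    · exact hxy
    · exact hM.1 e he
  · intro e he f hf hef v hv hv'
    rcases Finset.mem_insert.1 he with rfl | he <;> rcases Finset.mem_insert.1 hf with rfl | hf
    · exact hef rfl
    · have := hdisj f hf v hv'
      rcases Sym2.mem_iff.1 hv with h | h <;> simp_all
    · have := hdisj e he v hv
      rcases Sym2.mem_iff.1 hv' with h | h <;> simp_all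
    · exact hM.2 e he f hf hef v hv hv'
  · ext v
    simp only [coveredBy, Finset.mem_insert, exists_eq_or_imp, Sym2.mem_iff, Set.mem_ofPred_eq,
      Set.mem_union, Set.mem_insert_iff, Set.mem_singleton_iff]
    exact or_comm

/-- Rotating `N` towards `M` while keeping the vertices of `S` uncovered: either `N` can be
enlarged at the cost of at most one vertex of `S`, or it can be modified to cover every vertex
of `M` outside `S`. -/
theorem IsMatchingSet.exists_exchange [Fintype V] {G : SimpleGraph V} {M N : Finset (Sym2 V)}
    (hM : IsMatchingSet G M) (hN : IsMatchingSet G N) {S : Set V}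
    (hS : Disjoint S (coveredBy N)) :
    (∃ L, IsMatchingSet G L ∧ L.card = N.card ∧ Disjoint S (coveredBy L) ∧
      coveredBy M ⊆ coveredBy L ∪ S) ∨
    ∃ L, IsMatchingSet G L ∧ L.card = N.card + 1 ∧ (S ∩ coveredBy L).Subsingleton := by
  classical
  obtain ⟨L, hL, hmax⟩ := Finset.exists_max_image
    (Finset.univ.filter fun L : Finset (Sym2 V) =>
      IsMatchingSet G L ∧ L.card = N.card ∧ Disjoint S (coveredBy L))
    (fun L => (M ∩ L).card) ⟨N, by simp [hN, hS]⟩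
  simp only [Finset.mem_filter, Finset.mem_univ, true_and] at hL hmax
  obtain ⟨hL, hLc, hLS⟩ := hL
  by_cases hcov : coveredBy M ⊆ coveredBy L ∪ S
  · exact Or.inl ⟨L, hL, hLc, hLS, hcov⟩
  obtain ⟨x, hxM, hx⟩ := Set.not_subset.1 hcov
  simp only [Set.mem_union, not_or] at hx
  obtain ⟨hxL, hxS⟩ := hx
  obtain ⟨e, he, hxe⟩ := hxM
  obtain ⟨y, rfl⟩ := hxe
  have hxy : G.Adj x y := hM.1 _ he
  right
  by_cases hyL : y ∈ coveredBy L
  · exfalso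
    obtain ⟨f, hf, hyf⟩ := hyL
    have hfM : f ∉ M := by
      intro hfM
      have hne : s(x, y) ≠ f := by
        rintro rfl
        exact hxL ⟨_, hf, Sym2.mem_mk_left x y⟩
      exact hM.2 _ he f hfM hne y (Sym2.mem_mk_right x y) hyf
    have hE : IsMatchingSet G (L.erase f) := hL.subset (Finset.erase_subset _ _)
    have hcE : coveredBy (L.erase f) ⊆ coveredBy L := fun v ⟨e, he, hv⟩ =>
      ⟨e, Finset.mem_of_mem_erase he, hv⟩
    have hyE : y ∉ coveredBy (L.erase f) := by
      rintro ⟨g, hg, hyg⟩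
      exact hL.2 g (Finset.mem_of_mem_erase hg) f hf (Finset.ne_of_mem_erase hg) y hyg hyf
    obtain ⟨K, hK, hKc, hLK, hxyK, hcK⟩ := hE.exists_insert hxy (fun h => hxL (hcE h)) hyE
    have hKc' : K.card = N.card := by
      rw [hKc, Finset.card_erase_add_one hf, hLc]
    have hKS : Disjoint S (coveredBy K) := by
      rw [Set.disjoint_left]
      intro v hv hvK
      rw [hcK] at hvK
      rcases hvK with h | rfl | rfl
      · exact Set.disjoint_left.1 hLS hv (hcE h)
      · exact hxS hv
      · exact Set.disjoint_left.1 hLS hv ⟨f, hf, hyf⟩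
    have hlt : M ∩ L ⊂ M ∩ K := by
      refine (Finset.ssubset_iff_of_subset fun g hg => ?_).2
        ⟨s(x, y), Finset.mem_inter.2 ⟨he, hxyK⟩, fun h =>
          hxL ⟨_, (Finset.mem_inter.1 h).2, Sym2.mem_mk_left x y⟩⟩
      obtain ⟨hgM, hgL⟩ := Finset.mem_inter.1 hg
      refine Finset.mem_inter.2 ⟨hgM, hLK (Finset.mem_erase.2 ⟨?_, hgL⟩)⟩
      rintro rfl
      exact hfM hgM
    exact (Finset.card_lt_card hlt).not_ge (hmax K ⟨hK, hKc', hKS⟩)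
  · obtain ⟨K, hK, hKc, -, -, hcK⟩ := hL.exists_insert hxy hxL hyL
    refine ⟨K, hK, by rw [hKc, hLc], ?_⟩
    have key : ∀ v ∈ S ∩ coveredBy K, v = y := by
      rintro v ⟨hv, hvK⟩
      rw [hcK] at hvK
      rcases hvK with h | rfl | h
      · exact (Set.disjoint_left.1 hLS hv h).elim
      · exact (hxS hv).elim
      · exact h
    intro v hv w hw
    rw [key v hv, key w hw]

theorem mem_geD_iff {G : SimpleGraph V} {v : V} :
    v ∈ geD G ↔ ∃ M, IsMatchingSet G M ∧ M.card = matchingNumber G ∧ v ∉ coveredBy M := by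
  simp [geD, coveredBy]

theorem mem_geD_of_card [Fintype V] {G : SimpleGraph V} {v : V} {M : Finset (Sym2 V)}
    (hM : IsMatchingSet G M) (hc : matchingNumber G ≤ M.card) (hv : v ∉ coveredBy M) :
    v ∈ geD G :=
  mem_geD_iff.2 ⟨M, hM, le_antisymm hM.card_le_matchingNumber hc, hv⟩

theorem ncard_coveredBy_diff_comm [Fintype V] {G : SimpleGraph V} {M N : Finset (Sym2 V)}
    (hM : IsMatchingSet G M) (hN : IsMatchingSet G N) :
    2 * M.card + (coveredBy N \ coveredBy M).ncard =
      2 * N.card + (coveredBy M \ coveredBy N).ncard := by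
  rw [← hM.ncard_coveredBy, ← hN.ncard_coveredBy]
  have h₁ := Set.ncard_sdiff_add_ncard (coveredBy N) (coveredBy M) (Set.toFinite _) (Set.toFinite _)
  have h₂ := Set.ncard_sdiff_add_ncard (coveredBy M) (coveredBy N) (Set.toFinite _) (Set.toFinite _)
  rw [Set.union_comm] at h₂
  omega

/-- Gallai: on inessential vertices, not being simultaneously missed by a maximum matching is
a transitive relation. -/
theorem not_both_uncovered_trans [Fintype V] {G : SimpleGraph V} {u v w : V} (hw : w ∈ geD G)
    (huv : u ≠ v)
    (huw : ∀ M, IsMatchingSet G M → M.card = matchingNumber G → w ∉ coveredBy M →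
      u ∈ coveredBy M)
    (hvw : ∀ M, IsMatchingSet G M → M.card = matchingNumber G → w ∉ coveredBy M →
      v ∈ coveredBy M) :
    ∀ M, IsMatchingSet G M → M.card = matchingNumber G → v ∉ coveredBy M → u ∈ coveredBy M := by
  intro M hM hMc hvM
  by_contra huM
  obtain ⟨N, hN, hNc, hwN⟩ := mem_geD_iff.1 hw
  rcases hM.exists_exchange hN (S := {w}) (by simpa using hwN) with
    ⟨L, hL, hLc, hLS, hcov⟩ | ⟨L, hL, hLc, -⟩
  · rw [Set.disjoint_singleton_left] at hLS
    have huL := huw L hL (hLc.trans hNc) hLS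
    have hvL := hvw L hL (hLc.trans hNc) hLS
    have hcard := ncard_coveredBy_diff_comm hM hL
    have h₁ : (coveredBy M \ coveredBy L).ncard ≤ 1 := by
      rw [← Set.ncard_singleton w]
      refine Set.ncard_le_ncard ?_
      rw [Set.sdiff_subset_iff]
      exact hcov
    have h₂ : 2 ≤ (coveredBy L \ coveredBy M).ncard := by
      rw [← Set.ncard_pair huv]
      refine Set.ncard_le_ncard ?_
      rintro x (rfl | rfl)
      · exact ⟨huL, huM⟩
      · exact ⟨hvL, hvM⟩
    omega
  · have := hL.card_le_matchingNumber
    omega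

theorem removeIncident_le (G : SimpleGraph V) (S : Set V) : removeIncident G S ≤ G :=
  fun _ _ h => h.1

theorem removeIncident_anti (G : SimpleGraph V) {S T : Set V} (h : S ⊆ T) :
    removeIncident G T ≤ removeIncident G S :=
  fun _ _ hab => ⟨hab.1, fun ha => hab.2.1 (h ha), fun hb => hab.2.2 (h hb)⟩

theorem removeIncident_removeIncident (G : SimpleGraph V) (S T : Set V) :
    removeIncident (removeIncident G S) T = removeIncident G (S ∪ T) := by
  ext a b
  simp only [removeIncident, Set.mem_union]
  tauto

theorem removeIncident_empty (G : SimpleGraph V) : removeIncident G ∅ = G := by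
  ext a b
  simp [removeIncident]

theorem isMatchingSet_removeIncident_iff {G : SimpleGraph V} {S : Set V} {M : Finset (Sym2 V)} :
    IsMatchingSet (removeIncident G S) M ↔ IsMatchingSet G M ∧ Disjoint S (coveredBy M) := by
  constructor
  · intro h
    refine ⟨h.mono (removeIncident_le G S), Set.disjoint_left.2 ?_⟩
    rintro v hv ⟨e, he, ⟨w, rfl⟩⟩
    exact (h.1 _ he : (removeIncident G S).Adj v w).2.1 hv
  · rintro ⟨h, hS⟩
    refine ⟨fun e he => ?_, h.2⟩
    induction e with
    | h a b =>
      exact ⟨h.1 _ he, fun ha => Set.disjoint_left.1 hS ha ⟨_, he, Sym2.mem_mk_left a b⟩,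
        fun hb => Set.disjoint_left.1 hS hb ⟨_, he, Sym2.mem_mk_right a b⟩⟩

theorem mem_geD_iff_matchingNumber_le [Fintype V] {G : SimpleGraph V} {v : V} :
    v ∈ geD G ↔ matchingNumber G ≤ matchingNumber (removeIncident G {v}) := by
  constructor
  · intro h
    obtain ⟨M, hM, hc, hv⟩ := mem_geD_iff.1 h
    rw [← hc]
    exact (isMatchingSet_removeIncident_iff.2
      ⟨hM, Set.disjoint_singleton_left.2 hv⟩).card_le_matchingNumber
  · intro h
    obtain ⟨M, hM, hc⟩ := exists_isMatchingSet_card_eq (removeIncident G {v})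
    obtain ⟨hM, hv⟩ := isMatchingSet_removeIncident_iff.1 hM
    exact mem_geD_of_card hM (hc ▸ h) (Set.disjoint_singleton_left.1 hv)

theorem matchingNumber_le_removeIncident_singleton_add_one [Fintype V] (G : SimpleGraph V)
    (v : V) : matchingNumber G ≤ matchingNumber (removeIncident G {v}) + 1 := by
  classical
  obtain ⟨M, hM, hc⟩ := exists_isMatchingSet_card_eq G
  by_cases hv : v ∈ coveredBy M
  · obtain ⟨e, he, hve⟩ := hv
    have hE : IsMatchingSet (removeIncident G {v}) (M.erase e) := by
      refine isMatchingSet_removeIncident_iff.2 ⟨hM.subset (Finset.erase_subset _ _), ?_⟩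
      rw [Set.disjoint_singleton_left]
      rintro ⟨f, hf, hvf⟩
      exact hM.2 f (Finset.mem_of_mem_erase hf) e he (Finset.ne_of_mem_erase hf) v hvf hve
    rw [← hc, ← Finset.card_erase_add_one he]
    exact Nat.add_le_add_right hE.card_le_matchingNumber 1
  · exact (mem_geD_iff_matchingNumber_le.1 (mem_geD_iff.2 ⟨M, hM, hc, hv⟩)).trans (Nat.le_succ _)

theorem matchingNumber_eq_removeIncident_singleton_add_one [Fintype V] {G : SimpleGraph V} {a : V}
    (ha : a ∉ geD G) : matchingNumber G = matchingNumber (removeIncident G {a}) + 1 := by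
  have h₁ := matchingNumber_le_removeIncident_singleton_add_one G a
  rw [mem_geD_iff_matchingNumber_le] at ha
  omega

/-- The stability lemma: deleting a vertex of `A` does not create inessential vertices. -/
theorem mem_geD_of_mem_geD_removeIncident [Fintype V] {G : SimpleGraph V} {a v : V}
    (ha : a ∈ geA G) (hva : v ≠ a) (hv : v ∈ geD (removeIncident G {a})) : v ∈ geD G := by
  by_contra hvD
  obtain ⟨haD, u, huD, hau⟩ := ha
  have hν := matchingNumber_eq_removeIncident_singleton_add_one haD
  obtain ⟨N, hN, hNc, hvN⟩ := mem_geD_iff.1 hv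
  obtain ⟨hN, haN⟩ := isMatchingSet_removeIncident_iff.1 hN
  rw [Set.disjoint_singleton_left] at haN
  obtain ⟨M, hM, hMc, huM⟩ := mem_geD_iff.1 huD
  have huv : u ≠ v := by
    rintro rfl
    exact hvD huD
  have hS : Disjoint ({a, v} : Set V) (coveredBy N) := by
    rw [Set.disjoint_left]
    rintro x (rfl | rfl)
    · exact haN
    · exact hvN
  rcases hM.exists_exchange hN hS with ⟨L, hL, hLc, hLS, hcov⟩ | ⟨L, hL, hLc, hsub⟩
  · have haL : a ∉ coveredBy L := Set.disjoint_left.1 hLS (Set.mem_insert _ _)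
    have hvL : v ∉ coveredBy L := Set.disjoint_left.1 hLS (by simp)
    have hcard := ncard_coveredBy_diff_comm hM hL
    have h₁ : (coveredBy M \ coveredBy L).ncard ≤ 2 := by
      rw [← Set.ncard_pair hva.symm]
      refine Set.ncard_le_ncard ?_
      rw [Set.sdiff_subset_iff]
      exact hcov
    have huL : u ∉ coveredBy L := by
      intro huL
      have : 0 < (coveredBy L \ coveredBy M).ncard :=
        (Set.ncard_pos (Set.toFinite _)).2 ⟨u, huL, huM⟩
      omega
    obtain ⟨K, hK, hKc, -, -, hcK⟩ := hL.exists_insert hau haL huL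
    refine hvD (mem_geD_of_card hK (by omega) ?_)
    rw [hcK]
    rintro (h | h | h)
    · exact hvL h
    · exact hva h
    · exact huv h.symm
  · have hc : matchingNumber G ≤ L.card := by omega
    by_cases haL : a ∈ coveredBy L
    · refine hvD (mem_geD_of_card hL hc fun hvL => hva ?_)
      exact hsub ⟨by simp, hvL⟩ ⟨by simp, haL⟩
    · exact haD (mem_geD_of_card hL hc haL)

theorem geD_subset_geD_removeIncident [Fintype V] {G : SimpleGraph V} {a : V}
    (ha : a ∉ geD G) : geD G ⊆ geD (removeIncident G {a}) := by
  classical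
  intro v hv
  obtain ⟨M, hM, hMc, hvM⟩ := mem_geD_iff.1 hv
  have hν := matchingNumber_eq_removeIncident_singleton_add_one ha
  have haM : a ∈ coveredBy M := by
    by_contra h
    exact ha (mem_geD_iff.2 ⟨M, hM, hMc, h⟩)
  obtain ⟨e, he, hae⟩ := haM
  refine mem_geD_of_card (M := M.erase e) (isMatchingSet_removeIncident_iff.2
    ⟨hM.subset (Finset.erase_subset _ _), ?_⟩) ?_ ?_
  · rw [Set.disjoint_singleton_left]
    rintro ⟨f, hf, haf⟩
    exact hM.2 f (Finset.mem_of_mem_erase hf) e he (Finset.ne_of_mem_erase hf) a haf hae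
  · have := Finset.card_erase_add_one he
    omega
  · rintro ⟨f, hf, hvf⟩
    exact hvM ⟨f, Finset.mem_of_mem_erase hf, hvf⟩

theorem matchingNumber_removeIncident_add_card [Fintype V] (B : Finset V) :
    ∀ G : SimpleGraph V, ↑B ⊆ geA G →
      matchingNumber (removeIncident G B) + B.card = matchingNumber G := by
  classical
  induction B using Finset.induction_on with
  | empty => intro G _; simp [removeIncident_empty]
  | insert a B haB ih =>
    intro G hB
    have ha : a ∈ geA G := hB (by simp)
    have key := ih (removeIncident G {a}) fun b hb => by
      have hba : b ≠ a := by
        rintro rfl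
        exact haB hb
      obtain ⟨hbD, u, hu, hbu⟩ := hB (Finset.mem_coe.2 (Finset.mem_insert_of_mem hb))
      refine ⟨fun h => hbD (mem_geD_of_mem_geD_removeIncident ha hba h), u,
        geD_subset_geD_removeIncident ha.1 hu, hbu, hba, ?_⟩
      rintro rfl
      exact ha.1 hu
    have hν := matchingNumber_eq_removeIncident_singleton_add_one ha.1
    rw [removeIncident_removeIncident] at key
    rw [Finset.coe_insert, Set.insert_eq, Finset.card_insert_of_notMem haB]
    omega

/-- The Gallai–Edmonds identity `ν(G - A) + |A| = ν(G)`. -/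
theorem matchingNumber_removeIncident_geA_add_ncard [Fintype V] (G : SimpleGraph V) :
    matchingNumber (removeIncident G (geA G)) + (geA G).ncard = matchingNumber G := by
  classical
  have h := matchingNumber_removeIncident_add_card (geA G).toFinset G (by simp)
  rwa [Set.coe_toFinset, ← Set.ncard_eq_toFinset_card'] at h

theorem inducedOn_le (G : SimpleGraph V) (S : Set V) : inducedOn G S ≤ G :=
  fun _ _ h => h.1

theorem IsMatchingSet.mem_of_inducedOn {G : SimpleGraph V} {S : Set V} {M : Finset (Sym2 V)}
    (hM : IsMatchingSet (inducedOn G S) M) {e : Sym2 V} (he : e ∈ M) {v : V} (hv : v ∈ e) :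
    v ∈ S := by
  obtain ⟨w, rfl⟩ := hv
  exact (hM.1 _ he : (inducedOn G S).Adj v w).2.1

theorem two_mul_matchingNumber_inducedOn_le [Fintype V] (G : SimpleGraph V) (S : Set V) :
    2 * matchingNumber (inducedOn G S) ≤ S.ncard := by
  obtain ⟨M, hM, hc⟩ := exists_isMatchingSet_card_eq (inducedOn G S)
  rw [← hc, ← hM.ncard_coveredBy]
  refine Set.ncard_le_ncard ?_
  rintro v ⟨e, he, hv⟩
  exact hM.mem_of_inducedOn he hv

theorem IsMatchingSet.filter_inducedOn {G : SimpleGraph V} {M : Finset (Sym2 V)}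
    (hM : IsMatchingSet G M) (K : Set V)
    [DecidablePred fun e : Sym2 V => ∀ v ∈ e, v ∈ K] :
    IsMatchingSet (inducedOn G K) (M.filter fun e => ∀ v ∈ e, v ∈ K) := by
  refine ⟨fun e he => ?_, (hM.subset (Finset.filter_subset _ _)).2⟩
  obtain ⟨he, hK⟩ := Finset.mem_filter.1 he
  induction e with
  | h a b => exact ⟨hM.1 _ he, hK a (Sym2.mem_mk_left a b), hK b (Sym2.mem_mk_right a b)⟩

/-- The matching number is additive over a family of disjoint vertex sets containing all
edges. -/
theorem matchingNumber_eq_sum_inducedOn [Fintype V] {G : SimpleGraph V} {P : Finset (Set V)}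
    (hP : (P : Set (Set V)).PairwiseDisjoint id)
    (hcov : ∀ a b, G.Adj a b → ∃ K ∈ P, a ∈ K ∧ b ∈ K) :
    matchingNumber G = ∑ K ∈ P, matchingNumber (inducedOn G K) := by
  classical
  apply le_antisymm
  · obtain ⟨M, hM, hc⟩ := exists_isMatchingSet_card_eq G
    have hsub : M ⊆ P.biUnion fun K => M.filter fun e => ∀ v ∈ e, v ∈ K := by
      intro e he
      induction e with
      | h a b =>
        obtain ⟨K, hK, ha, hb⟩ := hcov a b (hM.1 _ he)
        refine Finset.mem_biUnion.2 ⟨K, hK, Finset.mem_filter.2 ⟨he, fun v hv => ?_⟩⟩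
        rcases Sym2.mem_iff.1 hv with rfl | rfl
        · exact ha
        · exact hb
    rw [← hc]
    refine (Finset.card_le_card hsub).trans (Finset.card_biUnion_le.trans ?_)
    exact Finset.sum_le_sum fun K _ => (hM.filter_inducedOn K).card_le_matchingNumber
  · choose M hM hc using fun K => exists_isMatchingSet_card_eq (inducedOn G K)
    have hdisj : ∀ K ∈ P, ∀ L ∈ P, ∀ e ∈ M K, ∀ f ∈ M L, ∀ v ∈ e, v ∈ f → K = L := by
      intro K hK L hL e he f hf v hve hvf
      by_contra hKL
      exact Set.disjoint_left.1 (hP hK hL hKL) ((hM K).mem_of_inducedOn he hve)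
        ((hM L).mem_of_inducedOn hf hvf)
    have hU : IsMatchingSet G (P.biUnion M) := by
      constructor
      · intro e he
        obtain ⟨K, -, he⟩ := Finset.mem_biUnion.1 he
        exact SimpleGraph.edgeSet_mono (inducedOn_le G K) ((hM K).1 e he)
      · intro e he f hf hef v hve hvf
        obtain ⟨K, hK, he⟩ := Finset.mem_biUnion.1 he
        obtain ⟨L, hL, hf⟩ := Finset.mem_biUnion.1 hf
        obtain rfl := hdisj K hK L hL e he f hf v hve hvf
        exact (hM K).2 e he f hf hef v hve hvf
    rw [← Finset.sum_congr rfl fun K _ => hc K, ← Finset.card_biUnion]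
    · exact hU.card_le_matchingNumber
    · intro K hK L hL hKL
      refine Finset.disjoint_left.2 fun e he hf => hKL ?_
      exact hdisj K hK L hL e he e hf e.out.1 e.out_fst_mem e.out_fst_mem

theorem compSet_eq_of_mem {G : SimpleGraph V} {u v : V} (h : u ∈ compSet G v) :
    compSet G u = compSet G v := by
  ext w
  exact ⟨fun hw => hw.trans h, fun hw => hw.trans (SimpleGraph.Reachable.symm h)⟩

theorem mem_compSet_self (G : SimpleGraph V) (v : V) : v ∈ compSet G v :=
  SimpleGraph.Reachable.refl v

theorem mem_compSet_of_adj {G : SimpleGraph V} {u v : V} (h : G.Adj u v) : u ∈ compSet G v :=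
  h.reachable

theorem pairwiseDisjoint_compSet {G : SimpleGraph V} {P : Set (Set V)}
    (hP : ∀ K ∈ P, ∃ v, K = compSet G v) : P.PairwiseDisjoint id := by
  intro K hK L hL hKL
  obtain ⟨u, rfl⟩ := hP K hK
  obtain ⟨v, rfl⟩ := hP L hL
  refine Set.disjoint_left.2 fun w hu hv => hKL ?_
  exact (compSet_eq_of_mem hu).symm.trans (compSet_eq_of_mem hv)

theorem compSet_inducedOn_subset {G : SimpleGraph V} {S : Set V} {v : V} (hv : v ∈ S) :
    compSet (inducedOn G S) v ⊆ S := by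
  rintro u ⟨w⟩
  cases w with
  | nil => exact hv
  | cons h _ => exact h.2.1

theorem inducedOn_removeIncident (G : SimpleGraph V) (K S : Set V) :
    inducedOn (removeIncident G S) K = inducedOn G (K \ S) := by
  ext a b
  simp only [inducedOn, removeIncident, Set.mem_sdiff]
  tauto

theorem mem_geA_of_notMem_geD {G : SimpleGraph V} (hC : geC G = ∅) {v : V} (hv : v ∉ geD G) :
    v ∈ geA G := by
  by_contra h
  exact (Set.eq_empty_iff_forall_notMem.1 hC v) ⟨hv, h⟩

theorem matchingNumber_removeIncident_geA_union [Fintype V] {G : SimpleGraph V}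
    (hC : geC G = ∅) (T : Set V) :
    matchingNumber (removeIncident G (geA G ∪ T)) =
      ∑ K ∈ (Set.toFinite (compsOn G (geD G))).toFinset,
        matchingNumber (inducedOn G (K \ T)) := by
  rw [matchingNumber_eq_sum_inducedOn (P := (Set.toFinite (compsOn G (geD G))).toFinset)]
  · refine Finset.sum_congr rfl fun K hK => ?_
    rw [Set.Finite.mem_toFinset] at hK
    obtain ⟨v, hv, rfl⟩ := hK
    rw [inducedOn_removeIncident]
    congr 2
    ext u
    have : u ∈ compSet (inducedOn G (geD G)) v → u ∉ geA G := fun hu hA =>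
      hA.1 (compSet_inducedOn_subset hv hu)
    simp only [Set.mem_sdiff, Set.mem_union]
    tauto
  · rw [Set.Finite.coe_toFinset]
    refine pairwiseDisjoint_compSet (G := inducedOn G (geD G)) ?_
    rintro K ⟨v, -, rfl⟩
    exact ⟨v, rfl⟩
  · rintro a b ⟨hab, ha, hb⟩
    have hD : ∀ x, x ∉ geA G ∪ T → x ∈ geD G := by
      intro x hx
      by_contra h
      exact hx (Or.inl (mem_geA_of_notMem_geD hC h))
    refine ⟨compSet (inducedOn G (geD G)) a, ?_, mem_compSet_self _ _,
      mem_compSet_of_adj ⟨hab.symm, hD b hb, hD a ha⟩⟩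
    rw [Set.Finite.mem_toFinset]
    exact ⟨a, hD a ha, rfl⟩

theorem sigmaCol_eq [Fintype V] {q : ℕ} {Gc : Fin q → SimpleGraph V}
    (hAD : ∀ j, geC (Gc j) = ∅) (T : Set V) :
    sigmaCol Gc T =
      ∑ j, (((geA (Gc j) ∩ T).ncard : ℤ) + matchingNumber (removeIncident (Gc j) (geA (Gc j)))
        - matchingNumber (removeIncident (Gc j) (geA (Gc j) ∪ T))) - T.ncard := by
  unfold sigmaCol
  rw [← Finset.sum_add_distrib]
  congr 1
  refine Finset.sum_congr rfl fun j _ => ?_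
  have h := matchingNumber_removeIncident_geA_union (hAD j) ∅
  simp only [Set.union_empty, Set.sdiff_empty] at h
  rw [finsum_mem_eq_finite_toFinset_sum _ (Set.toFinite _), Finset.sum_sub_distrib, h,
    matchingNumber_removeIncident_geA_union (hAD j) T]
  push_cast
  ring

/-- In a graph all of whose vertices are inessential, a maximum matching misses at most one
vertex of each component. -/
theorem mem_coveredBy_of_reachable [Fintype V] {G : SimpleGraph V} (hG : geD G = Set.univ)
    {u v : V} (h : G.Reachable u v) : u ≠ v →
    ∀ M, IsMatchingSet G M → M.card = matchingNumber G → v ∉ coveredBy M → u ∈ coveredBy M := by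
  obtain ⟨p⟩ := h
  induction p with
  | nil => exact fun h => (h rfl).elim
  | @cons u w v huw p ih =>
    intro huv
    have hadj : ∀ M, IsMatchingSet G M → M.card = matchingNumber G → w ∉ coveredBy M →
        u ∈ coveredBy M := by
      intro M hM hc hw
      by_contra hu
      obtain ⟨N, hN, hNc, -⟩ := hM.exists_insert huw hu hw
      have := hN.card_le_matchingNumber
      omega
    by_cases hwv : w = v
    · exact hwv ▸ hadj
    · refine not_both_uncovered_trans (w := w) (hG ▸ Set.mem_univ w) huv hadj ?_
      intro M hM hc hw
      by_contra hv
      exact hw (ih hwv M hM hc hv)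

/-- Gallai's lemma: components of a graph without essential vertices have near-perfect
matchings. -/
theorem ncard_compSet_le [Fintype V] {G : SimpleGraph V} (hG : geD G = Set.univ) (v : V) :
    (compSet G v).ncard ≤ 2 * matchingNumber (inducedOn G (compSet G v)) + 1 := by
  classical
  obtain ⟨M, hM, hc, hv⟩ := mem_geD_iff.1 (hG ▸ Set.mem_univ v : v ∈ geD G)
  have hF := hM.filter_inducedOn (compSet G v)
  have hsub : compSet G v ⊆
      insert v (coveredBy (M.filter fun e => ∀ w ∈ e, w ∈ compSet G v)) := by
    intro u hu
    by_cases huv : u = v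
    · exact Or.inl huv
    obtain ⟨e, he, hue⟩ := mem_coveredBy_of_reachable hG hu huv M hM hc hv
    obtain ⟨w, rfl⟩ := hue
    refine Or.inr ⟨s(u, w), Finset.mem_filter.2 ⟨he, fun x hx => ?_⟩, Sym2.mem_mk_left u w⟩
    rcases Sym2.mem_iff.1 hx with rfl | rfl
    · exact hu
    · exact (hM.1 _ he : G.Adj u x).symm.reachable.trans hu
  have h₁ := Set.ncard_le_ncard hsub
  have h₂ := Set.ncard_insert_le v
    (coveredBy (M.filter fun e => ∀ w ∈ e, w ∈ compSet G v))
  rw [hF.ncard_coveredBy] at h₂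
  have h₃ := hF.card_le_matchingNumber
  omega

theorem matchingNumber_removeIncident_add_card_le [Fintype V] {G : SimpleGraph V}
    (hG : geD G = Set.univ) {S : Set V} {Q : Finset (Set V)}
    (hQ : ∀ K ∈ Q, (∃ v, K = compSet G v) ∧ 2 ≤ (K ∩ S).ncard) :
    matchingNumber (removeIncident G S) + Q.card ≤ matchingNumber G := by
  classical
  set P : Finset (Set V) := Finset.univ.image (compSet G)
  have hP : (P : Set (Set V)).PairwiseDisjoint id := by
    refine pairwiseDisjoint_compSet (G := G) fun K hK => ?_
    obtain ⟨v, -, rfl⟩ := Finset.mem_image.1 (Finset.mem_coe.1 hK)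
    exact ⟨v, rfl⟩
  have hcov : ∀ a b, G.Adj a b → ∃ K ∈ P, a ∈ K ∧ b ∈ K := fun a b hab =>
    ⟨compSet G a, Finset.mem_image_of_mem _ (Finset.mem_univ a), mem_compSet_self _ _,
      mem_compSet_of_adj hab.symm⟩
  have hQP : Q ⊆ P := by
    intro K hK
    obtain ⟨⟨v, rfl⟩, -⟩ := hQ K hK
    exact Finset.mem_image_of_mem _ (Finset.mem_univ v)
  have hQc : Q.card = ∑ K ∈ P, if K ∈ Q then 1 else 0 := by
    rw [Finset.sum_ite_mem, Finset.inter_eq_right.2 hQP, Finset.card_eq_sum_ones]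
  rw [matchingNumber_eq_sum_inducedOn hP hcov,
    matchingNumber_eq_sum_inducedOn (G := removeIncident G S) hP fun a b hab => hcov a b hab.1, hQc,
    ← Finset.sum_add_distrib]
  refine Finset.sum_le_sum fun K hK => ?_
  rw [inducedOn_removeIncident]
  split_ifs with hKQ
  · obtain ⟨⟨v, rfl⟩, h2⟩ := hQ K hKQ
    have h₁ := ncard_compSet_le hG v
    have h₂ := two_mul_matchingNumber_inducedOn_le G (compSet G v \ S)
    have h₃ := Set.ncard_inter_add_ncard_sdiff_eq_ncard (compSet G v) S
    omega
  · exact matchingNumber_mono fun a b h => ⟨h.1, h.2.1.1, h.2.2.1⟩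

/-- A finite hypergraph that is not a hyperforest has equally many, and at least one, vertices
and hyperedges such that each of these hyperedges contains two of these vertices. -/
theorem exists_of_not_isHyperforest [Fintype V] {ι : Type*} [Fintype ι] {E : ι → Set V}
    (h : ¬ IsHyperforest E) :
    ∃ (S : Finset V) (I : Finset ι), S.Nonempty ∧ S.card = I.card ∧
      ∀ i ∈ I, 2 ≤ (E i ∩ S).ncard := by
  classical
  simp only [IsHyperforest, SimpleGraph.IsAcyclic, not_forall, not_not] at h
  obtain ⟨x, c, hc⟩ := h
  set S : Finset V := Finset.univ.filter fun v => Sum.inl v ∈ c.support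
  set I : Finset ι := Finset.univ.filter fun i => Sum.inr i ∈ c.support
  have hsupp : ∀ {y z}, c.toSubgraph.Adj y z → y ∈ c.support := fun h =>
    c.mem_verts_toSubgraph.1 h.fst_mem
  have hadj : ∀ {v i}, c.toSubgraph.Adj (Sum.inl v) (Sum.inr i) → v ∈ E i := by
    intro v i h
    rcases h.adj_sub with ⟨v', i', hv, hi, hmem⟩ | ⟨v', i', hv, hi, hmem⟩
    · obtain rfl := Sum.inl_injective hv
      obtain rfl := Sum.inr_injective hi
      exact hmem
    · simp at hv
  have hdegS : ∀ v ∈ S, (Finset.bipartiteAbove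
      (fun v i => c.toSubgraph.Adj (Sum.inl v) (Sum.inr i)) I v).card = 2 := by
    intro v hv
    rw [← hc.ncard_neighborSet_toSubgraph_eq_two (Finset.mem_filter.1 hv).2,
      ← Set.ncard_coe_finset, ← Set.ncard_image_of_injective _ (Sum.inr_injective (α := V))]
    congr 1
    ext y
    constructor
    · rintro ⟨i, hi, rfl⟩
      exact (Finset.mem_filter.1 (Finset.mem_coe.1 hi)).2
    · intro hy
      rcases hy.adj_sub with ⟨v', i, -, rfl, -⟩ | ⟨v', i, hv', -, -⟩
      · exact ⟨i, Finset.mem_coe.2 (Finset.mem_filter.2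
          ⟨Finset.mem_filter.2 ⟨Finset.mem_univ _, hsupp hy.symm⟩, hy⟩), rfl⟩
      · simp at hv'
  have hdegI : ∀ i ∈ I, (Finset.bipartiteBelow
      (fun v i => c.toSubgraph.Adj (Sum.inl v) (Sum.inr i)) S i).card = 2 := by
    intro i hi
    rw [← hc.ncard_neighborSet_toSubgraph_eq_two (Finset.mem_filter.1 hi).2,
      ← Set.ncard_coe_finset, ← Set.ncard_image_of_injective _ (Sum.inl_injective (β := ι))]
    congr 1
    ext y
    constructor
    · rintro ⟨v, hv, rfl⟩
      exact (Finset.mem_filter.1 (Finset.mem_coe.1 hv)).2.symm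
    · intro hy
      rcases hy.adj_sub with ⟨v, i', hi', -, -⟩ | ⟨v, i', -, rfl, -⟩
      · simp at hi'
      · exact ⟨v, Finset.mem_coe.2 (Finset.mem_filter.2
          ⟨Finset.mem_filter.2 ⟨Finset.mem_univ _, hsupp hy.symm⟩, hy.symm⟩), rfl⟩
  have hcard : S.card = I.card := by
    have := Finset.sum_card_bipartiteAbove_eq_sum_card_bipartiteBelow
      (fun v i => c.toSubgraph.Adj (Sum.inl v) (Sum.inr i)) (s := S) (t := I)
    rw [Finset.sum_congr rfl hdegS, Finset.sum_congr rfl hdegI, Finset.sum_const,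
      Finset.sum_const, smul_eq_mul, smul_eq_mul] at this
    omega
  refine ⟨S, I, ?_, hcard, ?_⟩
  · rcases x with v | i
    · exact ⟨v, Finset.mem_filter.2 ⟨Finset.mem_univ _, c.start_mem_support⟩⟩
    · rw [← Finset.card_pos, hcard, Finset.card_pos]
      exact ⟨i, Finset.mem_filter.2 ⟨Finset.mem_univ _, c.start_mem_support⟩⟩
  · intro i hi
    rw [← hdegI i hi, ← Set.ncard_coe_finset]
    refine Set.ncard_le_ncard fun v hv => ?_
    obtain ⟨hvS, hv⟩ := Finset.mem_filter.1 (Finset.mem_coe.1 hv)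
    exact ⟨hadj hv, hvS⟩

theorem exists_drop_of_not_colouringAcyclic [Fintype V] {q : ℕ} {Gc : Fin q → SimpleGraph V}
    (hD : ∀ j, geD (Gc j) = Set.univ) (h : ¬ ColouringAcyclic Gc) :
    ∃ S : Set V, 0 < S.ncard ∧
      ∑ j, matchingNumber (removeIncident (Gc j) S) + S.ncard ≤ ∑ j, matchingNumber (Gc j) := by
  classical
  have : Finite (CompIdx Gc) := by
    unfold CompIdx
    infer_instance
  have := Fintype.ofFinite (CompIdx Gc)
  obtain ⟨S, I, hS, hSI, hI⟩ := exists_of_not_isHyperforest h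
  refine ⟨S, by rwa [Set.ncard_coe_finset, Finset.card_pos], ?_⟩
  rw [Set.ncard_coe_finset, hSI,
    Finset.card_eq_sum_card_fiberwise (f := fun p : CompIdx Gc => p.1) (t := Finset.univ)
      (fun _ _ => Finset.mem_coe.2 (Finset.mem_univ _)), ← Finset.sum_add_distrib]
  refine Finset.sum_le_sum fun j _ => ?_
  have hinj : Set.InjOn (CompEdge Gc) ↑(I.filter fun p : CompIdx Gc => p.1 = j) := by
    rintro ⟨j₁, K₁⟩ h₁ ⟨j₂, K₂⟩ h₂ h
    obtain rfl : j₁ = j := (Finset.mem_filter.1 (Finset.mem_coe.1 h₁)).2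
    obtain rfl : j₂ = j₁ := (Finset.mem_filter.1 (Finset.mem_coe.1 h₂)).2
    obtain rfl : K₁ = K₂ := Subtype.ext h
    rfl
  rw [← Finset.card_image_of_injOn hinj]
  refine matchingNumber_removeIncident_add_card_le (hD j) fun K hK => ?_
  obtain ⟨⟨j', K⟩, hp, rfl⟩ := Finset.mem_image.1 hK
  obtain ⟨hpI, rfl⟩ := Finset.mem_filter.1 hp
  exact ⟨K.2, hI _ hpI⟩

theorem SigmaMaximal.geA_subset [Fintype V] {q : ℕ} {Gc : Fin q → SimpleGraph V}
    (hAD : ∀ j, geC (Gc j) = ∅) {T : Set V} (hT : SigmaMaximal Gc T) (j : Fin q) :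
    geA (Gc j) ⊆ T := by
  intro a ha
  by_contra haT
  refine (hT.2 (insert a T) (Set.ssubset_insert haT)).not_ge ?_
  rw [sigmaCol_eq hAD, sigmaCol_eq hAD, Set.ncard_insert_of_notMem haT]
  have hmono : ∀ i, matchingNumber (removeIncident (Gc i) (geA (Gc i) ∪ insert a T)) ≤
      matchingNumber (removeIncident (Gc i) (geA (Gc i) ∪ T)) := fun i =>
    matchingNumber_mono (removeIncident_anti _
      (Set.union_subset_union_right _ (Set.subset_insert _ _)))
  have hA : ∀ i, (geA (Gc i) ∩ T).ncard + (if i = j then 1 else 0) ≤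
      (geA (Gc i) ∩ insert a T).ncard := by
    intro i
    split_ifs with hij
    · subst hij
      rw [Set.inter_insert_of_mem ha, Set.ncard_insert_of_notMem fun h => haT h.2]
    · exact Set.ncard_le_ncard (Set.inter_subset_inter_right _ (Set.subset_insert _ _))
  have hsum : ∑ i, ((((geA (Gc i) ∩ T).ncard : ℤ)
        + matchingNumber (removeIncident (Gc i) (geA (Gc i)))
        - matchingNumber (removeIncident (Gc i) (geA (Gc i) ∪ T))) + if i = j then 1 else 0) ≤
      ∑ i, (((geA (Gc i) ∩ insert a T).ncard : ℤ)
        + matchingNumber (removeIncident (Gc i) (geA (Gc i)))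
        - matchingNumber (removeIncident (Gc i) (geA (Gc i) ∪ insert a T))) := by
    refine Finset.sum_le_sum fun i _ => ?_
    have h₁ := hmono i
    have h₂ := hA i
    split_ifs at h₂ ⊢ <;> omega
  rw [Finset.sum_add_distrib, Finset.sum_ite_eq' Finset.univ j] at hsum
  simp only [Finset.mem_univ, if_true] at hsum
  push_cast
  linarith

theorem sigmaCol_of_geA_subset [Fintype V] {q : ℕ} {Gc : Fin q → SimpleGraph V}
    (hAD : ∀ j, geC (Gc j) = ∅) {T : Set V} (hT : ∀ j, geA (Gc j) ⊆ T) :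
    sigmaCol Gc T = ∑ j, (matchingNumber (Gc j) : ℤ)
      - ∑ j, (matchingNumber (removeIncident (Gc j) T) : ℤ) - T.ncard := by
  rw [sigmaCol_eq hAD, ← Finset.sum_sub_distrib]
  congr 1
  refine Finset.sum_congr rfl fun j _ => ?_
  have h := matchingNumber_removeIncident_geA_add_ncard (Gc j)
  rw [Set.inter_eq_left.2 (hT j), Set.union_eq_right.2 (hT j)]
  omega

theorem SigmaMaximal.sum_lt [Fintype V] {q : ℕ} {Gc : Fin q → SimpleGraph V}
    (hAD : ∀ j, geC (Gc j) = ∅) {T : Set V} (hT : SigmaMaximal Gc T) {S : Set V}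
    (hS : ¬ S ⊆ T) :
    ∑ j, matchingNumber (removeIncident (Gc j) T) <
      ∑ j, matchingNumber (removeIncident (removeIncident (Gc j) T) S) + S.ncard := by
  have hA := hT.geA_subset hAD
  have h := hT.2 (T ∪ S) (Set.ssubset_union_left_iff.2 hS)
  rw [sigmaCol_of_geA_subset hAD hA,
    sigmaCol_of_geA_subset hAD fun j => (hA j).trans Set.subset_union_left] at h
  have hc := Set.ncard_union_le T S
  simp only [removeIncident_removeIncident]
  zify at hc ⊢
  linarith

theorem SigmaMaximal.geD_removeIncident [Fintype V] {q : ℕ} {Gc : Fin q → SimpleGraph V}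
    (hAD : ∀ j, geC (Gc j) = ∅) {T : Set V} (hT : SigmaMaximal Gc T) (j : Fin q) :
    geD (removeIncident (Gc j) T) = Set.univ := by
  refine Set.eq_univ_of_forall fun v => mem_geD_iff_matchingNumber_le.2 ?_
  by_cases hv : v ∈ T
  · rw [removeIncident_removeIncident, Set.union_eq_left.2 (Set.singleton_subset_iff.2 hv)]
  · have h := hT.sum_lt hAD (S := {v}) (by simpa using hv)
    rw [Set.ncard_singleton, Nat.lt_succ_iff] at h
    by_contra hj
    refine h.not_gt (Finset.sum_lt_sum (fun i _ => ?_) ⟨j, Finset.mem_univ j, not_le.1 hj⟩)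
    exact matchingNumber_mono (removeIncident_le _ _)

theorem isMulticolouring_removeIncident {G : SimpleGraph V} {q : ℕ} {Gc : Fin q → SimpleGraph V}
    (hcol : IsMulticolouring G ⊥ Gc) (T : Set V) :
    IsMulticolouring G (⊥ ⊔ incidentSub G T) (fun j => removeIncident (Gc j) T) := by
  unfold IsMulticolouring at hcol ⊢
  rw [bot_sup_eq] at hcol ⊢
  ext a b
  have hab : G.Adj a b ↔ ∃ j, (Gc j).Adj a b := by
    rw [← hcol, SimpleGraph.iSup_adj]
  rw [SimpleGraph.sup_adj, SimpleGraph.iSup_adj]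
  constructor
  · rintro (h | ⟨j, h⟩)
    · exact h.1
    · exact hab.2 ⟨j, h.1⟩
  · intro h
    by_cases hT : a ∈ T ∨ b ∈ T
    · exact Or.inl ⟨h, hT⟩
    · obtain ⟨j, hj⟩ := hab.1 h
      rw [not_or] at hT
      exact Or.inr ⟨j, hj, hT⟩

theorem isSProper_removeIncident (G : SimpleGraph V) {q : ℕ} (Gc : Fin q → SimpleGraph V)
    (T : Set V) :
    IsSProper G (⊥ ⊔ incidentSub G T) (fun j => removeIncident (Gc j) T) T := by
  unfold IsSProper
  rw [bot_sup_eq]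
  constructor
  · ext e
    induction e with
    | h a b =>
      change G.Adj a b ∧ (a ∈ T ∨ b ∈ T) ↔ G.Adj a b ∧ ∃ v ∈ T, v ∈ s(a, b)
      simp [Sym2.mem_iff, and_or_left, exists_or]
  · intro j
    refine Set.disjoint_left.2 fun e he he' => ?_
    induction e with
    | h a b => exact he.2.elim he'.2.1 he'.2.2

/-- **Lemma 3.2 (Decycling).** Let `𝒢 = (G₀, G₁, …, G_q)` be a fully-coloured `AD`-pure
`q`-multicolouring of `G`, let `T` be `σ_𝒢`-maximal, and let `𝒢' = unclr(𝒢; T)`, i.e.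
`G'_0 = G₀ ⊔ (edges of G incident to T)` and `G'_j = G_j` minus the edges incident to `T`.
Then (1) `ν(G'_j) ≤ ν(G_j)` for every colour; (2) `∑_j ν(G'_j) ≤ ∑_j ν(G_j) - |T|`;
(3) `𝒢'` is a `T`-proper, `D`-pure, acyclic `q`-multicolouring of `G`. -/
theorem decycling {V : Type*} [Fintype V] {q : ℕ} (G G0 : SimpleGraph V)
    (Gc : Fin q → SimpleGraph V) (hcol : IsMulticolouring G G0 Gc)
    (hfull : G0 = ⊥) (hAD : ∀ j, geC (Gc j) = ∅)
    (T : Set V) (hT : SigmaMaximal Gc T) :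
    (∀ j, matchingNumber (removeIncident (Gc j) T) ≤ matchingNumber (Gc j)) ∧
    ((∑ j, matchingNumber (removeIncident (Gc j) T)) + T.ncard ≤ ∑ j, matchingNumber (Gc j)) ∧
    (IsMulticolouring G (G0 ⊔ incidentSub G T) (fun j => removeIncident (Gc j) T) ∧
      IsSProper G (G0 ⊔ incidentSub G T) (fun j => removeIncident (Gc j) T) T ∧
      (∀ j, geC (removeIncident (Gc j) T) = ∅ ∧ geA (removeIncident (Gc j) T) = ∅) ∧
      ColouringAcyclic (fun j => removeIncident (Gc j) T)) := by
  subst hfull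
  have hD := hT.geD_removeIncident hAD
  refine ⟨fun j => matchingNumber_mono (removeIncident_le _ _), ?_,
    isMulticolouring_removeIncident hcol T, isSProper_removeIncident G Gc T, fun j => ?_, ?_⟩
  · have h₀ : sigmaCol Gc ∅ = 0 := by simp [sigmaCol_eq hAD]
    have h := hT.1 ∅
    rw [h₀, sigmaCol_of_geA_subset hAD (hT.geA_subset hAD)] at h
    zify
    linarith
  · constructor <;> refine Set.eq_empty_iff_forall_notMem.2 fun v hv => hv.1 ?_ <;>
      exact hD j ▸ Set.mem_univ v
  · by_contra hcyc
    obtain ⟨S, hS, hle⟩ := exists_drop_of_not_colouringAcyclic hD hcyc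
    by_cases hST : S ⊆ T
    · simp only [removeIncident_removeIncident, Set.union_eq_left.2 hST] at hle
      omega
    · exact (hT.sum_lt hAD hST).not_ge hle
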